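/- (Appendix F, calibration of the distillation loss.) Let m ≥ 1, let G ∈ ℝ^{m×m}, let D ∈ ℝ^{m×m} be diagonal with D_yy > 0 for all y, set M = G D^{−1}, and let γ ∈ [0,1]. Let z ∈ Δ_m (the teacher's label distribution) be such that z̄ = Mᵀ z has z̄_y > 0 for all y. Define the distilled loss ℓ^dis(z, s) = −Σ_{y=1}^m z̄_y^{1−γ} log( exp(s_y − log D_yy − γ log z̄_y) / Σ_{j=1}^m exp(s_j − log D_jj − γ log z̄_j) ). Then the infimum of s ↦ ℓ^dis(z, s) over s ∈ ℝ^m is attained; a vector s* minimizes it if and only if there exists c ∈ ℝ with s*_y = log(D_yy z̄_y) + c = log((Gᵀ z)_y) + c for all y; and consequently every minimizer s* satisfies argmax_y s*_y = argmax_y (Gᵀ z)_y (as sets). -/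

import Mathlib

/-- The argmax set of `f` over `{1,…,m}`. -/
def argmaxSet {m : ℕ} (f : Fin m → ℝ) : Set (Fin m) :=
  {y | ∀ y', f y' ≤ f y}

theorem gibbs_aux {m : ℕ} (w p : Fin m → ℝ) (hw : ∀ y, 0 < w y) (hp : ∀ y, 0 < p y)
    (hsum : ∑ y, p y = ∑ y, w y) :
    ∑ y, w y * Real.log (p y) ≤ ∑ y, w y * Real.log (w y) ∧
    (∑ y, w y * Real.log (p y) = ∑ y, w y * Real.log (w y) → ∀ y, p y = w y) := by
  have key : ∀ y, w y * Real.log (p y) ≤ w y * Real.log (w y) + (p y - w y) := by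
    intro y
    have h := Real.log_le_sub_one_of_pos (div_pos (hp y) (hw y))
    rw [Real.log_div (hp y).ne' (hw y).ne'] at h
    have h2 := mul_le_mul_of_nonneg_left h (hw y).le
    have h3 : w y * (p y / w y - 1) = p y - w y := by
      have := (hw y).ne'
      field_simp
    rw [h3] at h2
    linarith
  have hs : ∑ y, (w y * Real.log (w y) + (p y - w y)) = ∑ y, w y * Real.log (w y) := by
    rw [Finset.sum_add_distrib, Finset.sum_sub_distrib, hsum]; ring
  refine ⟨hs ▸ Finset.sum_le_sum fun y _ => key y, fun he y => ?_⟩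
  have h := (Finset.sum_eq_sum_iff_of_le fun y _ => key y).1 (he.trans hs.symm) y (Finset.mem_univ y)
  by_contra hne
  have h1 : p y / w y ≠ 1 := fun h => hne ((div_eq_one_iff_eq (hw y).ne').1 h)
  have h := Real.log_lt_sub_one_of_pos (div_pos (hp y) (hw y)) h1
  rw [Real.log_div (hp y).ne' (hw y).ne'] at h
  have h2 := mul_lt_mul_of_pos_left h (hw y)
  have h3 : w y * (p y / w y - 1) = p y - w y := by
    have := (hw y).ne'
    field_simp
  rw [h3] at h2
  linarith

theorem softmax_aux {m : ℕ} (hm : 1 ≤ m) (w : Fin m → ℝ) (hw : ∀ y, 0 < w y) :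
    let F : (Fin m → ℝ) → ℝ := fun a =>
      -∑ y, w y * Real.log (Real.exp (a y) / ∑ j, Real.exp (a j))
    ∃ C : ℝ, (∀ a, C ≤ F a) ∧ ∀ a, F a = C ↔ ∃ c : ℝ, ∀ y, a y = Real.log (w y) + c := by
  intro F
  haveI : Nonempty (Fin m) := ⟨⟨0, hm⟩⟩
  have hW : 0 < ∑ y, w y := Finset.sum_pos (fun y _ => hw y) Finset.univ_nonempty
  have hS : ∀ a : Fin m → ℝ, 0 < ∑ j, Real.exp (a j) := fun a =>
    Finset.sum_pos (fun y _ => Real.exp_pos _) Finset.univ_nonempty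
  set W := ∑ y, w y with hWdef
  have hF : ∀ a, F a = -∑ y, w y * Real.log (W * (Real.exp (a y) / ∑ j, Real.exp (a j)))
      + W * Real.log W := by
    intro a
    have : ∀ y, w y * Real.log (W * (Real.exp (a y) / ∑ j, Real.exp (a j))) =
        w y * Real.log W + w y * Real.log (Real.exp (a y) / ∑ j, Real.exp (a j)) := by
      intro y
      rw [Real.log_mul hW.ne' (div_pos (Real.exp_pos _) (hS a)).ne']; ring
    simp only [F, this, Finset.sum_add_distrib, ← Finset.sum_mul, ← hWdef]
    ring
  have hg := fun a : Fin m → ℝ => gibbs_aux w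
    (fun y => W * (Real.exp (a y) / ∑ j, Real.exp (a j))) hw
    (fun y => mul_pos hW (div_pos (Real.exp_pos _) (hS a)))
    (by rw [← Finset.mul_sum, ← Finset.sum_div, div_self (hS a).ne', mul_one])
  refine ⟨-∑ y, w y * Real.log (w y) + W * Real.log W, fun a => ?_, fun a => ⟨fun h => ?_, ?_⟩⟩
  · rw [hF]; have := (hg a).1; linarith
  · rw [hF] at h
    have h2 := (hg a).2 (by linarith)
    refine ⟨Real.log (∑ j, Real.exp (a j)) - Real.log W, fun y => ?_⟩
    rw [← h2 y, Real.log_mul hW.ne' (div_pos (Real.exp_pos _) (hS a)).ne',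
      Real.log_div (Real.exp_pos _).ne' (hS a).ne', Real.log_exp]
    ring
  · rintro ⟨c, hc⟩
    have he : ∀ y, Real.exp (a y) = w y * Real.exp c := fun y => by
      rw [hc, Real.exp_add, Real.exp_log (hw y)]
    rw [hF]
    congr 2
    refine Finset.sum_congr rfl fun y _ => ?_
    congr 2
    simp only [he, ← Finset.sum_mul, ← hWdef]
    have := hW.ne'
    have := (Real.exp_pos c).ne'
    field_simp

/-- Appendix F: for a gain matrix `G`, a positive diagonal matrix
`D`, `M = G D⁻¹` (entrywise `M_{y,i} = G_{y,i}/D_{ii}`), `γ ∈ [0,1]`, and teacher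
labels `z ∈ Δ_m` with `z̄ = Mᵀ z` strictly positive, the distilled loss
`ℓ^dis(z, ·)` attains its infimum over `ℝ^m`; `s*` minimizes it iff
`s*_y = log(D_yy z̄_y) + c` for some constant `c`, where `D_yy z̄_y = (Gᵀ z)_y`;
and every minimizer satisfies `argmax_y s*_y = argmax_y (Gᵀ z)_y`. -/
theorem distillation_loss_calibrated {m : ℕ} (hm : 1 ≤ m)
    (G D : Matrix (Fin m) (Fin m) ℝ)
    (hDdiag : ∀ i j, i ≠ j → D i j = 0) (hDpos : ∀ y, 0 < D y y)
    (M : Matrix (Fin m) (Fin m) ℝ) (hM : ∀ y i, M y i = G y i / D i i)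
    (γ : ℝ) (hγ0 : 0 ≤ γ) (hγ1 : γ ≤ 1)
    (z : Fin m → ℝ) (hz : z ∈ stdSimplex ℝ (Fin m))
    (zbar : Fin m → ℝ) (hzbar : ∀ y, zbar y = ∑ i, M i y * z i)
    (hzbarpos : ∀ y, 0 < zbar y) :
    let L : (Fin m → ℝ) → ℝ := fun s =>
      -∑ y, (zbar y) ^ (1 - γ) *
        Real.log (Real.exp (s y - Real.log (D y y) - γ * Real.log (zbar y)) /
          ∑ j, Real.exp (s j - Real.log (D j j) - γ * Real.log (zbar j)))
    (∃ s : Fin m → ℝ, ∀ t : Fin m → ℝ, L s ≤ L t) ∧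
    (∀ y, D y y * zbar y = ∑ i, G i y * z i) ∧
    (∀ s : Fin m → ℝ,
      (∀ t : Fin m → ℝ, L s ≤ L t) ↔
        ∃ c : ℝ, ∀ y, s y = Real.log (D y y * zbar y) + c) ∧
    (∀ s : Fin m → ℝ, (∀ t : Fin m → ℝ, L s ≤ L t) →
      argmaxSet s = argmaxSet (fun y => ∑ i, G i y * z i)) := by
  intro L
  obtain ⟨C, hC1, hC2⟩ := softmax_aux hm (fun y => zbar y ^ (1 - γ))
    (fun y => Real.rpow_pos_of_pos (hzbarpos y) _)
  have hG : ∀ y, D y y * zbar y = ∑ i, G i y * z i := by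
    intro y
    rw [hzbar, Finset.mul_sum]
    refine Finset.sum_congr rfl fun i _ => ?_
    rw [hM]
    have := (hDpos y).ne'
    field_simp
  have hle : ∀ s, C ≤ L s := fun s =>
    hC1 (fun y => s y - Real.log (D y y) - γ * Real.log (zbar y))
  have hiff : ∀ s, L s = C ↔ ∃ c : ℝ, ∀ y, s y = Real.log (D y y * zbar y) + c := by
    intro s
    refine (hC2 (fun y => s y - Real.log (D y y) - γ * Real.log (zbar y))).trans
      (exists_congr fun c => forall_congr' fun y => ?_)
    simp only [Real.log_rpow (hzbarpos y),
      Real.log_mul (hDpos y).ne' (hzbarpos y).ne']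
    constructor <;> intro h <;> linarith
  have h0 : L (fun y => Real.log (D y y * zbar y)) = C :=
    (hiff _).2 ⟨0, fun y => (add_zero _).symm⟩
  have hmin : ∀ s, (∀ t, L s ≤ L t) ↔
      ∃ c : ℝ, ∀ y, s y = Real.log (D y y * zbar y) + c := by
    intro s
    rw [← hiff]
    exact ⟨fun h => le_antisymm (h0 ▸ h _) (hle s), fun h t => h ▸ hle t⟩
  refine ⟨⟨_, fun t => h0.le.trans (hle t)⟩, hG, hmin, fun s hs => ?_⟩
  obtain ⟨c, hc⟩ := (hmin s).1 hs
  ext y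
  simp only [argmaxSet, Set.mem_setOf_eq]
  refine forall_congr' fun y' => ?_
  rw [hc, hc, ← hG, ← hG, add_le_add_iff_right,
    Real.log_le_log_iff (mul_pos (hDpos _) (hzbarpos _)) (mul_pos (hDpos _) (hzbarpos _))]
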